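/- For every integer n ≥ 0, 2 · p(n) = ∑_{k=3}^{n+3} φ(k) · S_k^{≥3}(n+3), where p(n) is the number of partitions of n and φ is Euler's totient function. -/

import Mathlib

/-- `S_k^{≥ r}(n)`: the total number of parts equal to `k`, counted over all partitions of `n`
whose parts are all at least `r`. -/
def Sge (k r n : ℕ) : ℕ :=
  ∑ P : Nat.Partition n, if ∀ i ∈ P.parts, r ≤ i then P.parts.count k else 0

namespace Nat.Partition

/-- Summing over the partitions of `n + k` that contain the part `k` amounts to summing over the
partitions of `n` with an additional part `k`. -/
theorem sum_ite_mem_parts {k : ℕ} (hk : 0 < k) (n : ℕ) (g : Multiset ℕ → ℕ) :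
    ∑ P : Nat.Partition (n + k), (if k ∈ P.parts then g P.parts else 0) =
      ∑ Q : Nat.Partition n, g (k ::ₘ Q.parts) := by
  rw [← Finset.sum_filter]
  refine Finset.sum_bij' (fun P hP => ⟨P.parts.erase k, ?_, ?_⟩)
    (fun Q _ => ⟨k ::ₘ Q.parts, ?_, ?_⟩) ?_ ?_ ?_ ?_ ?_
  · exact fun hi => P.parts_pos (Multiset.mem_of_mem_erase hi)
  · have h := congrArg Multiset.sum (Multiset.cons_erase (Finset.mem_filter.1 hP).2)
    rw [Multiset.sum_cons, P.parts_sum] at h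
    omega
  · intro i hi
    rcases Multiset.mem_cons.1 hi with rfl | hi
    · exact hk
    · exact Q.parts_pos hi
  · rw [Multiset.sum_cons, Q.parts_sum, add_comm]
  · simp
  · simp
  · intro P hP
    exact Partition.ext (Multiset.cons_erase (Finset.mem_filter.1 hP).2)
  · intro Q _
    exact Partition.ext (Multiset.erase_cons_head _ _)
  · intro P hP
    simp only [Multiset.cons_erase (Finset.mem_filter.1 hP).2]

/-- The number of partitions of `n` whose parts are all at least `r`. -/
def cardGe (r n : ℕ) : ℕ :=
  ∑ P : Nat.Partition n, if ∀ i ∈ P.parts, r ≤ i then 1 else 0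

theorem cardGe_one (n : ℕ) : cardGe 1 n = Fintype.card (Nat.Partition n) := by
  have h (P : Nat.Partition n) : ∀ i ∈ P.parts, 1 ≤ i := fun _ hi => P.parts_pos hi
  simp only [cardGe, if_pos (h _), Finset.sum_const, Finset.card_univ, smul_eq_mul, mul_one]

theorem forall_succ_le_iff {r : ℕ} (s : Multiset ℕ) :
    (∀ i ∈ s, r + 1 ≤ i) ↔ (∀ i ∈ s, r ≤ i) ∧ r ∉ s := by
  constructor
  · exact fun h => ⟨fun i hi => (Nat.le_succ r).trans (h i hi), fun hr => by simpa using h r hr⟩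
  · rintro ⟨h, hr⟩ i hi
    exact lt_of_le_of_ne (h i hi) fun e => hr (e ▸ hi)

theorem cardGe_succ_of_lt {r n : ℕ} (h : n < r) : cardGe (r + 1) n = cardGe r n := by
  refine Finset.sum_congr rfl fun P _ => ?_
  have hr : r ∉ P.parts := fun hr => absurd (le_of_mem_parts hr) (by omega)
  simp only [forall_succ_le_iff, hr, not_false_eq_true, and_true]

theorem cardGe_add {r : ℕ} (hr : 0 < r) (n : ℕ) :
    cardGe r (n + r) = cardGe (r + 1) (n + r) + cardGe r n := by
  have h := sum_ite_mem_parts hr n fun s => if ∀ i ∈ s, r ≤ i then 1 else 0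
  have h' : cardGe r n =
      ∑ Q : Nat.Partition n, if ∀ i ∈ r ::ₘ Q.parts, r ≤ i then 1 else 0 := by
    simp [cardGe]
  rw [h', ← h, cardGe, cardGe, ← Finset.sum_add_distrib]
  refine Finset.sum_congr rfl fun P _ => ?_
  simp only [forall_succ_le_iff]
  split_ifs <;> simp_all

theorem cardGe_two_eq_sum (n : ℕ) :
    cardGe 2 n = ∑ t ∈ Finset.range (n + 1), (if 2 ∣ t then 1 else 0) * cardGe 3 (n - t) := by
  induction n using Nat.twoStepInduction with
  | zero => simp [cardGe_succ_of_lt (r := 2) (n := 0)]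
  | one => simp [Finset.sum_range_succ, cardGe_succ_of_lt (r := 2) (n := 1)]
  | more n ih _ =>
    rw [cardGe_add two_pos, ih, Finset.sum_range_succ' _ (n + 2), Finset.sum_range_succ' _ (n + 1)]
    have h (t : ℕ) : n + 2 - (t + 1 + 1) = n - t := by omega
    have h2 (t : ℕ) : 2 ∣ t + 1 + 1 ↔ 2 ∣ t := by omega
    simp only [h, h2]
    simp [add_comm]

theorem card_eq_sum_cardGe_three (n : ℕ) :
    Fintype.card (Nat.Partition n) =
      ∑ t ∈ Finset.range (n + 1), (t / 2 + 1) * cardGe 3 (n - t) := by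
  rw [← cardGe_one]
  induction n with
  | zero =>
    simp [cardGe_succ_of_lt (r := 2) (n := 0), cardGe_succ_of_lt (r := 1) (n := 0)]
  | succ n ih =>
    rw [cardGe_add one_pos, ih, cardGe_two_eq_sum, Finset.sum_range_succ' _ (n + 1),
      Finset.sum_range_succ' _ (n + 1), add_right_comm, ← Finset.sum_add_distrib]
    congr 1
    · refine Finset.sum_congr rfl fun t _ => ?_
      rw [Nat.add_sub_add_right, ← add_mul]
      congr 1
      split_ifs <;> omega

end Nat.Partition

open Nat.Partition

theorem Sge_of_lt {k n : ℕ} (r : ℕ) (h : n < k) : Sge k r n = 0 := by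
  refine Finset.sum_eq_zero fun P _ => ?_
  have hk : k ∉ P.parts := fun hk => absurd (le_of_mem_parts hk) (by omega)
  simp [hk]

theorem Sge_add {k r : ℕ} (hk : 0 < k) (hr : r ≤ k) (n : ℕ) :
    Sge k r (n + k) = Sge k r n + cardGe r n := by
  have h := sum_ite_mem_parts hk n fun s => if ∀ i ∈ s, r ≤ i then s.count k else 0
  have h' : Sge k r (n + k) = ∑ P : Nat.Partition (n + k),
      if k ∈ P.parts then (if ∀ i ∈ P.parts, r ≤ i then P.parts.count k else 0) else 0 := by
    refine Finset.sum_congr rfl fun P _ => ?_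
    split_ifs <;> simp_all
  rw [h', h, Sge, cardGe, ← Finset.sum_add_distrib]
  refine Finset.sum_congr rfl fun P _ => ?_
  simp only [Multiset.mem_cons, forall_eq_or_imp, hr, true_and, Multiset.count_cons_self]
  split_ifs <;> rfl

theorem Sge_eq_sum_cardGe {k r : ℕ} (hk : 0 < k) (hr : r ≤ k) (n : ℕ) :
    Sge k r n = ∑ m ∈ Finset.range n, if k ∣ m + 1 then cardGe r (n - (m + 1)) else 0 := by
  induction n using Nat.strong_induction_on with
  | _ n ih =>
    rcases lt_or_ge n k with h | h
    · rw [Sge_of_lt r h]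
      refine (Finset.sum_eq_zero fun m hm => if_neg fun hd => ?_).symm
      have := Nat.le_of_dvd m.succ_pos hd
      have := Finset.mem_range.1 hm
      omega
    · obtain ⟨n, rfl⟩ := Nat.exists_eq_add_of_le' h
      rw [Sge_add hk hr, ih n (by omega), add_comm n k, Finset.sum_range_add, add_comm]
      congr 1
      · rw [Finset.sum_eq_single (k - 1)]
        · simp [Nat.sub_add_cancel hk]
        · intro m hm hne
          refine if_neg fun hd => ?_
          have := Nat.le_of_dvd m.succ_pos hd
          have := Finset.mem_range.1 hm
          omega
        · intro hm
          exact absurd (Finset.mem_range.2 (by omega)) hm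
      · refine Finset.sum_congr rfl fun m _ => ?_
        rw [add_assoc, Nat.add_sub_add_left]
        simp

theorem sum_totient_dvd_three_le {m N : ℕ} (hm : 3 ≤ m) (hN : m ≤ N) :
    ∑ k ∈ Finset.Icc 3 N, (if k ∣ m then Nat.totient k else 0) = 2 * ((m - 3) / 2 + 1) := by
  have h : ∑ k ∈ Finset.Icc 1 N, (if k ∣ m then Nat.totient k else 0) = m := by
    rw [← Finset.sum_filter]
    conv_rhs => rw [← Nat.sum_totient m]
    refine Finset.sum_congr ?_ fun _ _ => rfl
    ext k
    simp only [Finset.mem_filter, Finset.mem_Icc, Nat.mem_divisors]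
    constructor
    · exact fun h => ⟨h.2, by omega⟩
    · rintro ⟨hd, -⟩
      have := Nat.le_of_dvd (by omega) hd
      exact ⟨⟨Nat.pos_of_dvd_of_pos hd (by omega), by omega⟩, hd⟩
  rw [← Finset.add_sum_Ioc_eq_sum_Icc (by omega : 1 ≤ N), ← Finset.Icc_add_one_left_eq_Ioc,
    ← Finset.add_sum_Ioc_eq_sum_Icc (by omega : 1 + 1 ≤ N), ← Finset.Icc_add_one_left_eq_Ioc] at h
  norm_num at h
  split_ifs at h <;> omega

/-- For every `n ≥ 0`, `2 · p(n) = ∑_{k=3}^{n+3} φ(k) · S_k^{≥3}(n+3)`. -/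
theorem two_mul_partition_eq_sum_totient (n : ℕ) :
    2 * Fintype.card (Nat.Partition n) =
      ∑ k ∈ Finset.Icc 3 (n + 3), Nat.totient k * Sge k 3 (n + 3) := by
  have hS : ∑ k ∈ Finset.Icc 3 (n + 3), Nat.totient k * Sge k 3 (n + 3) =
      ∑ m ∈ Finset.range (n + 3), (∑ k ∈ Finset.Icc 3 (n + 3),
        if k ∣ m + 1 then Nat.totient k else 0) * cardGe 3 (n + 3 - (m + 1)) := by
    simp_rw [Finset.sum_mul]
    rw [Finset.sum_comm]
    refine Finset.sum_congr rfl fun k hk => ?_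
    have hk3 := (Finset.mem_Icc.1 hk).1
    rw [Sge_eq_sum_cardGe (by omega) hk3, Finset.mul_sum]
    refine Finset.sum_congr rfl fun m _ => ?_
    split_ifs <;> simp
  have h0 (m : ℕ) (hm : m < 2) :
      ∑ k ∈ Finset.Icc 3 (n + 3), (if k ∣ m + 1 then Nat.totient k else 0) = 0 := by
    refine Finset.sum_eq_zero fun k hk => if_neg fun hd => ?_
    have := Nat.le_of_dvd m.succ_pos hd
    have := (Finset.mem_Icc.1 hk).1
    omega
  rw [hS, card_eq_sum_cardGe_three, Finset.mul_sum, Finset.sum_range_succ' _ (n + 2),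
    Finset.sum_range_succ' _ (n + 1), h0 0 (by omega), h0 (0 + 1) (by omega)]
  simp only [zero_mul, add_zero]
  refine Finset.sum_congr rfl fun t ht => ?_
  have := Finset.mem_range.1 ht
  rw [sum_totient_dvd_three_le (by omega) (by omega), Nat.add_sub_add_right, mul_assoc]
  congr 3
  omega
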